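/- For every n ≥ 3, the number wm(n, 2, 1) of isomorphism classes of weighted games on n voters with exactly two types of voters and exactly one type of shift-minimal winning coalition equals 2·(n − 2)² + 2; for n ≤ 2 it equals n − 1. -/

import Mathlib

def SimpleGame (n : ℕ) (χ : Finset (Fin n) → Prop) : Prop :=
  (∀ U V : Finset (Fin n), U ⊆ V → χ U → χ V) ∧ ¬ χ (∅ : Finset (Fin n)) ∧ χ Finset.univ

def IsRep {n : ℕ} (χ : Finset (Fin n) → Prop) (q : ℕ) (w : Fin n → ℕ) : Prop :=
  ∀ U : Finset (Fin n), χ U ↔ q ≤ ∑ i ∈ U, w i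

def IsWeighted {n : ℕ} (χ : Finset (Fin n) → Prop) : Prop :=
  ∃ q w, IsRep χ q w

def MinRep {n : ℕ} (χ : Finset (Fin n) → Prop) (q : ℕ) (w : Fin n → ℕ) : Prop :=
  IsRep χ q w ∧ ∀ q' w', IsRep χ q' w' → ∀ i, w i ≤ w' i

def Desir {n : ℕ} (χ : Finset (Fin n) → Prop) (i j : Fin n) : Prop :=
  ∀ U : Finset (Fin n), j ∈ U → i ∉ U → χ U → χ (insert i (U.erase j))

def VEquiv {n : ℕ} (χ : Finset (Fin n) → Prop) (i j : Fin n) : Prop :=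
  Desir χ i j ∧ Desir χ j i

def StrictDesir {n : ℕ} (χ : Finset (Fin n) → Prop) (i j : Fin n) : Prop :=
  Desir χ i j ∧ ¬ Desir χ j i

def NullVoter {n : ℕ} (χ : Finset (Fin n) → Prop) (i : Fin n) : Prop :=
  ∀ U : Finset (Fin n), χ (insert i U) ↔ χ U

def ShiftMinWin {n : ℕ} (χ : Finset (Fin n) → Prop) (U : Finset (Fin n)) : Prop :=
  χ U ∧ (∀ i ∈ U, ¬ χ (U.erase i)) ∧
    ∀ i ∈ U, ∀ j, j ∉ U → StrictDesir χ i j → ¬ χ (insert j (U.erase i))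

def ShiftMaxLose {n : ℕ} (χ : Finset (Fin n) → Prop) (U : Finset (Fin n)) : Prop :=
  ¬ χ U ∧ (∀ j, j ∉ U → χ (insert j U)) ∧
    ∀ j ∈ U, ∀ i, i ∉ U → StrictDesir χ i j → χ (insert i (U.erase j))

def TwoTypes {n : ℕ} (χ : Finset (Fin n) → Prop) (N1 N2 : Finset (Fin n)) : Prop :=
  N1.Nonempty ∧ N2.Nonempty ∧ Disjoint N1 N2 ∧ N1 ∪ N2 = Finset.univ ∧
  (∀ i ∈ N1, ∀ j ∈ N1, VEquiv χ i j) ∧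
  (∀ i ∈ N2, ∀ j ∈ N2, VEquiv χ i j) ∧
  (∀ i ∈ N1, ∀ j ∈ N2, StrictDesir χ i j)

noncomputable def NumWinTypes2 {n : ℕ} (χ : Finset (Fin n) → Prop) (N1 N2 : Finset (Fin n)) : ℕ :=
  Set.ncard {p : ℕ × ℕ | ∃ U, ShiftMinWin χ U ∧ p = ((U ∩ N1).card, (U ∩ N2).card)}

def LPFeasible {n : ℕ} (χ : Finset (Fin n) → Prop) (N1 N2 : Finset (Fin n))
    (w1 w2 q : ℝ) : Prop :=
  0 ≤ w1 ∧ 0 ≤ w2 ∧ 0 ≤ q ∧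
  (∀ U, ShiftMinWin χ U → q ≤ ((U ∩ N1).card : ℝ) * w1 + ((U ∩ N2).card : ℝ) * w2) ∧
  (∀ U, ShiftMaxLose χ U → ((U ∩ N1).card : ℝ) * w1 + ((U ∩ N2).card : ℝ) * w2 ≤ q - 1)

def GameIso (n : ℕ) (χ χ' : Finset (Fin n) → Prop) : Prop :=
  ∃ σ : Equiv.Perm (Fin n), ∀ U : Finset (Fin n), χ' U ↔ χ (U.image σ)

noncomputable def NumTypes (n : ℕ) (χ : Finset (Fin n) → Prop) : ℕ :=
  Set.ncard {S : Set (Fin n) | ∃ i, S = {j | VEquiv χ i j}}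

noncomputable def ClassCount (n : ℕ) (χ : Finset (Fin n) → Prop) (U : Finset (Fin n)) (i : Fin n) : ℕ :=
  Set.ncard {j : Fin n | j ∈ U ∧ VEquiv χ i j}

def SameType (n : ℕ) (χ : Finset (Fin n) → Prop) (U V : Finset (Fin n)) : Prop :=
  ∀ i, ClassCount n χ U i = ClassCount n χ V i

noncomputable def NumSMWTypes (n : ℕ) (χ : Finset (Fin n) → Prop) : ℕ :=
  Set.ncard {T : Set (Finset (Fin n)) | ∃ U, ShiftMinWin χ U ∧
    T = {V | ShiftMinWin χ V ∧ SameType n χ U V}}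

noncomputable def wmntr (n t r : ℕ) : ℕ :=
  Set.ncard {C : Set (Finset (Fin n) → Prop) | ∃ χ, SimpleGame n χ ∧ IsWeighted χ ∧
    NumTypes n χ = t ∧ NumSMWTypes n χ = r ∧ C = {χ' | GameIso n χ χ'}}

noncomputable def wmnt (n t : ℕ) : ℕ :=
  Set.ncard {C : Set (Finset (Fin n) → Prop) | ∃ χ, SimpleGame n χ ∧ IsWeighted χ ∧
    NumTypes n χ = t ∧ C = {χ' | GameIso n χ χ'}}

def PreservesTypes {n : ℕ} (χ : Finset (Fin n) → Prop) (w : Fin n → ℕ) : Prop :=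
  ∀ i j, VEquiv χ i j → w i = w j

def MinRepPT {n : ℕ} (χ : Finset (Fin n) → Prop) (q : ℕ) (w : Fin n → ℕ) : Prop :=
  IsRep χ q w ∧ PreservesTypes χ w ∧
    ∀ q' w', IsRep χ q' w' → PreservesTypes χ w' → ∀ i, w i ≤ w' i

def Repre (a b k : ℕ) : Prop := ∃ u v : ℕ, u * a + v * b = k

def Wvec (t a b : ℕ) (l : Fin t → ℕ) (k : Fin t) : Fin (t + b + a) → ℕ :=
  fun i => if h : (i : ℕ) < t then
      (a * b - l ⟨(i : ℕ), h⟩ - 1) + (if (i : ℕ) = (k : ℕ) then 0 else 1)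
    else if (i : ℕ) < t + b then a else b

/-- The two-type game with a single shift-minimal winning type `(a, b)`. -/
def MG {n : ℕ} (A : Finset (Fin n)) (a b : ℕ) (U : Finset (Fin n)) : Prop :=
  a ≤ (U ∩ A).card ∧ a + b ≤ U.card

lemma card_swap {n : ℕ} {U : Finset (Fin n)} {i j : Fin n} (hj : j ∈ U) (hi : i ∉ U) :
    (insert i (U.erase j)).card = U.card := by
  rw [Finset.card_insert_of_notMem (by simp [hi]), Finset.card_erase_of_mem hj]
  have := Finset.card_pos.2 ⟨j, hj⟩
  omega

lemma card_inter_add {n : ℕ} (U A : Finset (Fin n)) :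
    (U ∩ A).card + (U \ A).card = U.card := by
  rw [add_comm]; exact Finset.card_sdiff_add_card_inter U A

lemma card_inter_insert {n : ℕ} (A : Finset (Fin n)) {U : Finset (Fin n)} {i : Fin n} (hi : i ∉ U) :
    ((insert i U) ∩ A).card = (U ∩ A).card + (if i ∈ A then 1 else 0) := by
  by_cases h : i ∈ A
  · rw [Finset.insert_inter_of_mem h, Finset.card_insert_of_notMem (by simp [hi])]; simp [h]
  · rw [Finset.insert_inter_of_notMem h]; simp [h]

lemma card_inter_erase {n : ℕ} (A : Finset (Fin n)) {U : Finset (Fin n)} {i : Fin n} (hi : i ∈ U) :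
    ((U.erase i) ∩ A).card + (if i ∈ A then 1 else 0) = (U ∩ A).card := by
  have := card_inter_insert A (Finset.notMem_erase i U)
  rw [Finset.insert_erase hi] at this
  omega

lemma card_inter_swap {n : ℕ} (A : Finset (Fin n)) {U : Finset (Fin n)} {i j : Fin n}
    (hj : j ∈ U) (hi : i ∉ U) :
    ((insert i (U.erase j)) ∩ A).card + (if j ∈ A then 1 else 0)
      = (U ∩ A).card + (if i ∈ A then 1 else 0) := by
  have h1 := card_inter_insert A (U := U.erase j) (i := i) (by simp [hi])
  have h2 := card_inter_erase A hj
  omega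

lemma inter_union_of {n : ℕ} {A X Y : Finset (Fin n)} (hX : X ⊆ A) (hY : Y ⊆ Aᶜ) :
    (X ∪ Y) ∩ A = X := by
  ext x
  have h1 := @hX x
  have h2 := @hY x
  simp only [Finset.mem_inter, Finset.mem_union, Finset.mem_compl] at *
  tauto

lemma card_union_of {n : ℕ} {A X Y : Finset (Fin n)} (hX : X ⊆ A) (hY : Y ⊆ Aᶜ) :
    (X ∪ Y).card = X.card + Y.card := by
  apply Finset.card_union_of_disjoint
  exact Finset.disjoint_of_subset_left hX
    (Finset.disjoint_of_subset_right hY disjoint_compl_right)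

lemma MG_desir_of {n : ℕ} {A : Finset (Fin n)} {a b : ℕ} {i j : Fin n} (h : i ∈ A ∨ j ∉ A) :
    Desir (MG A a b) i j := by
  intro U hj hi hU
  have h1 := card_swap hj hi
  have h2 := card_inter_swap A hj hi
  refine ⟨?_, by rw [h1]; exact hU.2⟩
  have := hU.1
  rcases h with h | h <;> simp only [h, if_true, if_false] at h2 <;> split_ifs at h2 <;> omega

lemma MG_desir {n : ℕ} {A : Finset (Fin n)} {a b : ℕ} (ha : 1 ≤ a) (haA : a ≤ A.card)
    (hb : b < (Aᶜ).card) (i j : Fin n) :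
    Desir (MG A a b) i j ↔ (i ∈ A ∨ j ∉ A) := by
  refine ⟨fun h => ?_, MG_desir_of⟩
  by_contra hc
  push Not at hc
  obtain ⟨hi, hj⟩ := hc
  obtain ⟨X, hX, hXc⟩ := Finset.exists_subset_card_eq (s := A.erase j) (n := a - 1)
    (by rw [Finset.card_erase_of_mem hj]; omega)
  obtain ⟨Y, hY, hYc⟩ := Finset.exists_subset_card_eq (s := Aᶜ.erase i) (n := b)
    (by rw [Finset.card_erase_of_mem (by simpa using hi)]; omega)
  have hjX : j ∉ X := fun h => by simpa using hX h
  have hiY : i ∉ Y := fun h => by simpa using hY h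
  have hX' : insert j X ⊆ A := Finset.insert_subset hj (hX.trans (Finset.erase_subset _ _))
  have hY' : Y ⊆ Aᶜ := hY.trans (Finset.erase_subset _ _)
  have hc1 : (insert j X).card = a := by
    rw [Finset.card_insert_of_notMem hjX, hXc]; omega
  have hjU : j ∈ insert j X ∪ Y := by simp
  have hiU : i ∉ insert j X ∪ Y := by
    simp only [Finset.mem_union, not_or]
    exact ⟨fun h => hi (hX' h), hiY⟩
  have hW : MG A a b (insert j X ∪ Y) := by
    constructor
    · rw [inter_union_of hX' hY', hc1]
    · rw [card_union_of hX' hY', hc1, hYc]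
  have h3 := (h _ hjU hiU hW).1
  have h4 := card_inter_swap A hjU hiU
  rw [inter_union_of hX' hY', hc1] at h4
  simp only [hi, hj, if_true, if_false] at h4
  omega

lemma MG_vequiv {n : ℕ} {A : Finset (Fin n)} {a b : ℕ} (ha : 1 ≤ a) (haA : a ≤ A.card)
    (hb : b < (Aᶜ).card) (i j : Fin n) :
    VEquiv (MG A a b) i j ↔ (i ∈ A ↔ j ∈ A) := by
  unfold VEquiv
  rw [MG_desir ha haA hb, MG_desir ha haA hb]
  tauto

lemma MG_smw {n : ℕ} {A : Finset (Fin n)} {a b : ℕ} (ha : 1 ≤ a) (haA : a ≤ A.card)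
    (hb : b < (Aᶜ).card) (U : Finset (Fin n)) :
    ShiftMinWin (MG A a b) U ↔ ((U ∩ A).card = a ∧ U.card = a + b) := by
  have key := card_inter_add U A
  constructor
  · rintro ⟨⟨h1, h2⟩, h3, h4⟩
    have hA : (U ∩ A).card = a := by
      by_contra hne
      have hpos : 0 < (U ∩ A).card := by omega
      obtain ⟨i, hi⟩ := Finset.card_pos.1 hpos
      obtain ⟨hiU, hiA⟩ := Finset.mem_inter.1 hi
      by_cases hlt : a + b < U.card
      · apply h3 i hiU
        have e1 := card_inter_erase A hiU
        simp only [hiA, if_true] at e1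
        refine ⟨by omega, ?_⟩
        rw [Finset.card_erase_of_mem hiU]; omega
      · have hex : ∃ j, j ∈ Aᶜ \ (U \ A) := by
          apply Finset.card_pos.1
          have := Finset.le_card_sdiff (U \ A) Aᶜ
          omega
        obtain ⟨j, hj⟩ := hex
        have hjA : j ∉ A := by simp at hj; tauto
        have hjU : j ∉ U := by simp at hj; tauto
        apply h4 i hiU j hjU
        · unfold StrictDesir
          rw [MG_desir ha haA hb, MG_desir ha haA hb]
          tauto
        · have e1 := card_inter_swap A hiU hjU
          simp only [hiA, hjA, if_true, if_false] at e1
          refine ⟨by omega, ?_⟩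
          rw [card_swap hiU hjU]; exact h2
    refine ⟨hA, ?_⟩
    by_contra hne
    have hpos : 0 < (U \ A).card := by omega
    obtain ⟨i, hi⟩ := Finset.card_pos.1 hpos
    obtain ⟨hiU, hiA⟩ := Finset.mem_sdiff.1 hi
    apply h3 i hiU
    have e1 := card_inter_erase A hiU
    simp only [hiA, if_false] at e1
    refine ⟨by omega, ?_⟩
    rw [Finset.card_erase_of_mem hiU]; omega
  · rintro ⟨h1, h2⟩
    refine ⟨⟨h1.ge, h2.ge⟩, ?_, ?_⟩
    · intro i hi h
      have := h.2
      rw [Finset.card_erase_of_mem hi] at this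
      omega
    · intro i hi j hj hs h
      unfold StrictDesir at hs
      rw [MG_desir ha haA hb, MG_desir ha haA hb] at hs
      have e1 := card_inter_swap A hi hj
      have hiA : i ∈ A := by tauto
      have hjA : j ∉ A := by tauto
      simp only [hiA, hjA, if_true, if_false] at e1
      have := h.1
      omega

lemma exists_type {n : ℕ} {A : Finset (Fin n)} {a b : ℕ} (haA : a ≤ A.card)
    (hb : b < (Aᶜ).card) : ∃ U : Finset (Fin n), (U ∩ A).card = a ∧ U.card = a + b := by
  obtain ⟨X, hX, hXc⟩ := Finset.exists_subset_card_eq haA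
  obtain ⟨Y, hY, hYc⟩ := Finset.exists_subset_card_eq hb.le
  exact ⟨X ∪ Y, by rw [inter_union_of hX hY, hXc], by rw [card_union_of hX hY, hXc, hYc]⟩

lemma MG_simple {n : ℕ} {A : Finset (Fin n)} {a b : ℕ} (ha : 1 ≤ a) (haA : a ≤ A.card)
    (hb : b < (Aᶜ).card) : SimpleGame n (MG A a b) := by
  refine ⟨?_, ?_, ?_⟩
  · intro U V h ⟨h1, h2⟩
    exact ⟨h1.trans (Finset.card_le_card (Finset.inter_subset_inter_right h)),
      h2.trans (Finset.card_le_card h)⟩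
  · rintro ⟨h1, h2⟩
    simp at h1; omega
  · have := Finset.card_add_card_compl A
    refine ⟨by simpa using haA, ?_⟩
    rw [Finset.card_univ]; omega

lemma MG_numTypes {n : ℕ} {A : Finset (Fin n)} {a b : ℕ} (ha : 1 ≤ a) (haA : a ≤ A.card)
    (hb : b < (Aᶜ).card) : NumTypes n (MG A a b) = 2 := by
  unfold NumTypes
  obtain ⟨i0, hi0⟩ := Finset.card_pos.1 (show 0 < A.card by omega)
  obtain ⟨j0, hj0⟩ := Finset.card_pos.1 (show 0 < Aᶜ.card by omega)
  have hj0' : j0 ∉ A := by simpa using hj0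
  rw [Set.ncard_eq_two]
  refine ⟨{j | j ∈ A}, {j | j ∉ A}, ?_, ?_⟩
  · intro h
    have : i0 ∈ {j | j ∉ A} := h ▸ hi0
    exact this hi0
  · ext S
    simp only [MG_vequiv ha haA hb, Set.mem_ofPred_eq, Set.mem_insert_iff, Set.mem_singleton_iff]
    constructor
    · rintro ⟨i, rfl⟩
      by_cases hi : i ∈ A <;> simp [hi]
    · rintro (rfl | rfl)
      · exact ⟨i0, by simp [hi0]⟩
      · exact ⟨j0, by simp [hj0']⟩

lemma MG_sameType {n : ℕ} {A : Finset (Fin n)} {a b : ℕ} (ha : 1 ≤ a) (haA : a ≤ A.card)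
    (hb : b < (Aᶜ).card) {U V : Finset (Fin n)} (h1 : (U ∩ A).card = (V ∩ A).card)
    (h2 : U.card = V.card) : SameType n (MG A a b) U V := by
  intro i
  unfold ClassCount
  simp only [MG_vequiv ha haA hb]
  have k1 := card_inter_add U A
  have k2 := card_inter_add V A
  by_cases hi : i ∈ A
  · have e : ∀ W : Finset (Fin n), {j | j ∈ W ∧ (i ∈ A ↔ j ∈ A)} = ((W ∩ A : Finset (Fin n)) : Set (Fin n)) := by
      intro W; ext j; simp [hi]
    rw [e, e, Set.ncard_coe_finset, Set.ncard_coe_finset, h1]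
  · have e : ∀ W : Finset (Fin n), {j | j ∈ W ∧ (i ∈ A ↔ j ∈ A)} = ((W \ A : Finset (Fin n)) : Set (Fin n)) := by
      intro W; ext j; simp [hi]
    rw [e, e, Set.ncard_coe_finset, Set.ncard_coe_finset]
    omega

lemma MG_numSMW {n : ℕ} {A : Finset (Fin n)} {a b : ℕ} (ha : 1 ≤ a) (haA : a ≤ A.card)
    (hb : b < (Aᶜ).card) : NumSMWTypes n (MG A a b) = 1 := by
  unfold NumSMWTypes
  rw [Set.ncard_eq_one]
  refine ⟨{V | ShiftMinWin (MG A a b) V}, ?_⟩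
  have main : ∀ U, ShiftMinWin (MG A a b) U →
      {V | ShiftMinWin (MG A a b) V ∧ SameType n (MG A a b) U V}
        = {V | ShiftMinWin (MG A a b) V} := by
    intro U hU
    ext V
    simp only [Set.mem_ofPred_eq, and_iff_left_iff_imp]
    intro hV
    rw [MG_smw ha haA hb] at hU hV
    exact MG_sameType ha haA hb (by omega) (by omega)
  ext T
  simp only [Set.mem_ofPred_eq, Set.mem_singleton_iff]
  constructor
  · rintro ⟨U, hU, rfl⟩
    exact main U hU
  · rintro rfl
    obtain ⟨U, hU⟩ := exists_type haA hb
    have hU' := (MG_smw ha haA hb U).2 hU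
    exact ⟨U, hU', (main U hU').symm⟩

lemma sum_two {n : ℕ} (A U : Finset (Fin n)) (x y : ℕ) :
    ∑ i ∈ U, (if i ∈ A then x else y) = (U ∩ A).card * x + (U \ A).card * y := by
  rw [Finset.sum_ite, Finset.sum_const, Finset.sum_const, Finset.filter_mem_eq_inter,
    Finset.filter_notMem_eq_sdiff]
  simp

lemma MG_weighted {n : ℕ} {A : Finset (Fin n)} {a b : ℕ}
    (haA : a ≤ A.card) (hb : b < (Aᶜ).card) (hc : b ≤ 1 ∨ a = A.card ∨ b + 1 = (Aᶜ).card) :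
    IsWeighted (MG A a b) := by
  have rep : ∀ q x y : ℕ, (∀ s t : ℕ, s ≤ A.card → t ≤ (Aᶜ).card →
      ((a ≤ s ∧ a + b ≤ s + t) ↔ q ≤ s * x + t * y)) → IsWeighted (MG A a b) := by
    intro q x y h
    refine ⟨q, fun i => if i ∈ A then x else y, fun U => ?_⟩
    rw [sum_two]
    unfold MG
    rw [← card_inter_add U A]
    apply h
    · exact Finset.card_le_card Finset.inter_subset_right
    · apply Finset.card_le_card
      intro z hz
      simp at hz ⊢
      exact hz.2
  generalize A.card = n1 at *
  generalize (Aᶜ).card = n2 at *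
  rcases hc with hc | hc | hc
  · interval_cases b
    · refine rep a 1 0 fun s t _ _ => by omega
    · rcases Nat.eq_zero_or_pos n2 with h0 | h0
      · omega
      refine rep (a * n2 + 1) n2 1 fun s t _ ht => ?_
      rcases lt_trichotomy s a with h | h | h
      · obtain ⟨k, rfl⟩ := Nat.exists_eq_add_of_lt h
        constructor
        · omega
        · intro h'; exfalso; nlinarith [Nat.zero_le (k * n2)]
      · subst h; omega
      · obtain ⟨k, rfl⟩ := Nat.exists_eq_add_of_lt h
        constructor
        · intro _; nlinarith [Nat.zero_le (k * n2)]
        · omega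
  · subst hc
    refine rep (a * (n2 + 1) + b) (n2 + 1) 1 fun s t hs ht => ?_
    rcases hs.lt_or_eq with h | h
    · obtain ⟨k, rfl⟩ := Nat.exists_eq_add_of_lt h
      constructor
      · omega
      · intro h'; exfalso; nlinarith [Nat.zero_le (k * n2)]
    · subst h; omega
  · refine rep ((a + b) * (n1 + 1) + a) (n1 + 2) (n1 + 1) fun s t hs ht => ?_
    have e : s * (n1 + 2) + t * (n1 + 1) = (s + t) * (n1 + 1) + s := by ring
    rw [e]
    rcases lt_trichotomy (s + t) (a + b) with h | h | h
    · constructor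
      · omega
      · intro h'; exfalso
        have : (s + t + 1) * (n1 + 1) ≤ (a + b) * (n1 + 1) := Nat.mul_le_mul_right _ h
        nlinarith
    · rw [h]; omega
    · have : (a + b + 1) * (n1 + 1) ≤ (s + t) * (n1 + 1) := Nat.mul_le_mul_right _ h
      constructor
      · intro _; nlinarith
      · intro _; omega

lemma exists_two {n : ℕ} (B : Finset (Fin n)) (p x : ℕ) (h : p + x + x ≤ B.card) :
    ∃ P X Y : Finset (Fin n), P ⊆ B ∧ X ⊆ B ∧ Y ⊆ B ∧ Disjoint P X ∧ Disjoint P Y ∧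
      Disjoint X Y ∧ P.card = p ∧ X.card = x ∧ Y.card = x := by
  obtain ⟨P, hP, hPc⟩ := Finset.exists_subset_card_eq (s := B) (n := p) (by omega)
  have c1 := Finset.card_sdiff_add_card_eq_card hP
  obtain ⟨X, hX, hXc⟩ := Finset.exists_subset_card_eq (s := B \ P) (n := x) (by omega)
  have c2 := Finset.card_sdiff_add_card_eq_card hX
  obtain ⟨Y, hY, hYc⟩ := Finset.exists_subset_card_eq (s := (B \ P) \ X) (n := x) (by omega)
  refine ⟨P, X, Y, hP, hX.trans Finset.sdiff_subset,
    hY.trans (Finset.sdiff_subset.trans Finset.sdiff_subset), ?_, ?_, ?_, hPc, hXc, hYc⟩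
  · exact Finset.disjoint_of_subset_right hX Finset.disjoint_sdiff
  · exact Finset.disjoint_of_subset_right (hY.trans Finset.sdiff_subset) Finset.disjoint_sdiff
  · exact Finset.disjoint_of_subset_right hY Finset.disjoint_sdiff

lemma MG_cond_of_weighted {n : ℕ} {A : Finset (Fin n)} {a b : ℕ} (ha : 1 ≤ a)
    (haA : a ≤ A.card) (hb : b < (Aᶜ).card) (hw : IsWeighted (MG A a b)) :
    b ≤ 1 ∨ a = A.card ∨ b + 1 = (Aᶜ).card := by
  by_contra hc
  push Not at hc
  obtain ⟨h1, h2, h3⟩ := hc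
  obtain ⟨q, w, hrep⟩ := hw
  obtain ⟨P, X, X', hP, hX, hX', dPX, dPX', dXX, cP, cX, cX'⟩ := exists_two A (a - 1) 1 (by omega)
  obtain ⟨Q, Y, Y', hQ, hY, hY', dQY, dQY', dYY, cQ, cY, cY'⟩ :=
    exists_two Aᶜ (b - 2) 2 (by omega)
  have win : ∀ S T : Finset (Fin n), S ⊆ A → T ⊆ Aᶜ →
      ((a ≤ S.card ∧ a + b ≤ S.card + T.card) ↔ q ≤ ∑ i ∈ S, w i + ∑ i ∈ T, w i) := by
    intro S T hS hT
    have := hrep (S ∪ T)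
    unfold MG at this
    rw [inter_union_of hS hT, card_union_of hS hT, Finset.sum_union] at this
    · exact this
    · exact Finset.disjoint_of_subset_left hS
        (Finset.disjoint_of_subset_right hT disjoint_compl_right)
  have g1 := win (P ∪ X) (Q ∪ Y) (Finset.union_subset hP hX) (Finset.union_subset hQ hY)
  have g2 := win (P ∪ X') (Q ∪ Y') (Finset.union_subset hP hX') (Finset.union_subset hQ hY')
  have dQ : Disjoint (Q ∪ Y) Y' := Finset.disjoint_union_left.2 ⟨dQY', dYY⟩
  have dP : Disjoint (P ∪ X) X' := Finset.disjoint_union_left.2 ⟨dPX', dXX⟩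
  have g3 := win P ((Q ∪ Y) ∪ Y') hP (Finset.union_subset (Finset.union_subset hQ hY) hY')
  have g4 := win ((P ∪ X) ∪ X') Q (Finset.union_subset (Finset.union_subset hP hX) hX') hQ
  rw [Finset.card_union_of_disjoint dPX, Finset.card_union_of_disjoint dQY,
    Finset.sum_union dPX, Finset.sum_union dQY] at g1
  rw [Finset.card_union_of_disjoint dPX', Finset.card_union_of_disjoint dQY',
    Finset.sum_union dPX', Finset.sum_union dQY'] at g2
  rw [Finset.card_union_of_disjoint dQ, Finset.card_union_of_disjoint dQY,
    Finset.sum_union dQ, Finset.sum_union dQY] at g3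
  rw [Finset.card_union_of_disjoint dP, Finset.card_union_of_disjoint dPX,
    Finset.sum_union dP, Finset.sum_union dPX] at g4
  have r1 := g1.1 (by omega)
  have r2 := g2.1 (by omega)
  have r3 := mt g3.2 (by omega)
  have r4 := mt g4.2 (by omega)
  omega

lemma desir_refl {n : ℕ} (χ : Finset (Fin n) → Prop) (i : Fin n) : Desir χ i i :=
  fun _ h1 h2 _ => absurd h1 h2

lemma desir_trans {n : ℕ} {χ : Finset (Fin n) → Prop} {i j k : Fin n}
    (h1 : Desir χ i j) (h2 : Desir χ j k) : Desir χ i k := by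
  intro U hk hi hU
  by_cases hij : i = j
  · subst hij; exact h2 U hk hi hU
  by_cases hjk : j = k
  · subst hjk; exact h1 U hk hi hU
  have hik : i ≠ k := fun h => hi (h ▸ hk)
  by_cases hj : j ∈ U
  · have a1 := h1 U hj hi hU
    have a2 := h2 (insert i (U.erase j)) (by simp [hk, Ne.symm hjk]) (by simp [Ne.symm hij]) a1
    convert a2 using 1
    ext x
    simp only [Finset.mem_insert, Finset.mem_erase]
    by_cases hx : x = j
    · subst hx; simp [hj, hjk]
    · by_cases hx2 : x = i
      · subst hx2; simp [hik]
      · simp [hx, hx2]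
  · have a1 := h2 U hk hj hU
    have a2 := h1 (insert j (U.erase k)) (by simp) (by simp [hij, hi]) a1
    convert a2 using 2
    rw [Finset.erase_insert (by simp [hj])]

lemma desir_total {n : ℕ} {χ : Finset (Fin n) → Prop} (hw : IsWeighted χ) (i j : Fin n) :
    Desir χ i j ∨ Desir χ j i := by
  obtain ⟨q, w, h⟩ := hw
  have main : ∀ i j : Fin n, w j ≤ w i → Desir χ i j := by
    intro i j hij U hj hi hU
    rw [h] at hU ⊢
    rw [Finset.sum_insert (by simp [hi])]
    have := Finset.add_sum_erase U w hj
    omega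
  rcases le_total (w j) (w i) with h' | h'
  · exact Or.inl (main _ _ h')
  · exact Or.inr (main _ _ h')

lemma dominate {n : ℕ} {χ : Finset (Fin n) → Prop} (hs : SimpleGame n χ) (A : Finset (Fin n))
    (hd : ∀ i j, (i ∈ A ∨ j ∉ A) → Desir χ i j) (V : Finset (Fin n)) :
    ∀ (m : ℕ) (U : Finset (Fin n)), (U \ V).card = m → χ U → (U ∩ A).card ≤ (V ∩ A).card →
      U.card ≤ V.card → χ V := by
  intro m
  induction m with
  | zero =>
    intro U h hU _ _
    rw [Finset.card_eq_zero, Finset.sdiff_eq_empty_iff_subset] at h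
    exact hs.1 _ _ h hU
  | succ m ih =>
    intro U h hU h1 h2
    have step : ∀ k j, k ∈ U → k ∉ V → j ∈ V → j ∉ U → (j ∈ A ∨ k ∉ A) →
        ((insert j (U.erase k)) ∩ A).card ≤ (V ∩ A).card → χ V := by
      intro k j hk hkV hjV hj hor hle
      refine ih (insert j (U.erase k)) ?_ (hd j k hor U hk hj hU) hle
        (by rw [card_swap hk hj]; exact h2)
      have : insert j (U.erase k) \ V = (U \ V).erase k := by
        ext x
        simp only [Finset.mem_sdiff, Finset.mem_insert, Finset.mem_erase]
        constructor
        · rintro ⟨rfl | hx, hxV⟩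
          · exact absurd hjV hxV
          · exact ⟨hx.1, hx.2, hxV⟩
        · rintro ⟨hx1, hx2, hx3⟩
          exact ⟨Or.inr ⟨hx1, hx2⟩, hx3⟩
      rw [this, Finset.card_erase_of_mem (by simp [hk, hkV])]
      omega
    by_cases hex : ∃ k, k ∈ U ∧ k ∉ V ∧ k ∈ A
    · obtain ⟨k, hk, hkV, hkA⟩ := hex
      have : ∃ j, j ∈ V ∩ A ∧ j ∉ U ∩ A := by
        by_contra hcon
        push Not at hcon
        have hss : V ∩ A ⊂ U ∩ A :=
          Finset.ssubset_iff_subset_ne.2 ⟨hcon, fun he => hkV (by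
            have : k ∈ V ∩ A := by rw [he]; simp [hk, hkA]
            exact (Finset.mem_inter.1 this).1)⟩
        have := Finset.card_lt_card hss
        omega
      obtain ⟨j, hj, hjU⟩ := this
      obtain ⟨hjV, hjA⟩ := Finset.mem_inter.1 hj
      have hjU' : j ∉ U := fun h => hjU (Finset.mem_inter.2 ⟨h, hjA⟩)
      apply step k j hk hkV hjV hjU' (Or.inl hjA)
      have := card_inter_swap A hk hjU'
      simp only [hkA, hjA, if_true] at this
      omega
    · push Not at hex
      obtain ⟨k, hk⟩ := Finset.card_pos.1 (show 0 < (U \ V).card by omega)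
      obtain ⟨hkU, hkV⟩ := Finset.mem_sdiff.1 hk
      have : ∃ j, j ∈ V ∧ j ∉ U := by
        by_contra hcon
        push Not at hcon
        have hss : V ⊂ U :=
          Finset.ssubset_iff_subset_ne.2 ⟨hcon, fun he => hkV (by rw [he]; exact hkU)⟩
        have := Finset.card_lt_card hss
        omega
      obtain ⟨j, hjV, hjU⟩ := this
      apply step k j hkU hkV hjV hjU (Or.inr (hex k hkU hkV))
      apply Finset.card_le_card
      intro x hx
      simp only [Finset.mem_inter, Finset.mem_insert, Finset.mem_erase] at hx ⊢
      refine ⟨?_, hx.2⟩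
      rcases hx.1 with rfl | hx1
      · exact hjV
      · by_contra hxV
        exact hex x hx1.2 hxV hx.2

lemma exists_smw {n : ℕ} {χ : Finset (Fin n) → Prop} (A : Finset (Fin n))
    (hd : ∀ i j, StrictDesir χ i j → i ∈ A ∧ j ∉ A) :
    ∀ (m : ℕ) (V : Finset (Fin n)), V.card + (V ∩ A).card ≤ m → χ V →
      ∃ U, ShiftMinWin χ U ∧ (U ∩ A).card ≤ (V ∩ A).card ∧ U.card ≤ V.card := by
  intro m
  induction m with
  | zero =>
    intro V h hV
    have hV0 : V = ∅ := Finset.card_eq_zero.1 (by omega)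
    subst hV0
    exact ⟨∅, ⟨hV, by simp, by simp⟩, le_rfl, le_rfl⟩
  | succ m ih =>
    intro V h hV
    by_cases hS : ShiftMinWin χ V
    · exact ⟨V, hS, le_rfl, le_rfl⟩
    by_cases h1 : ∃ i ∈ V, χ (V.erase i)
    · obtain ⟨i, hi, hw⟩ := h1
      have e1 := Finset.card_erase_of_mem hi
      have e2 := Finset.card_pos.2 ⟨i, hi⟩
      have e3 := card_inter_erase A hi
      obtain ⟨U, hU, hU1, hU2⟩ := ih (V.erase i) (by omega) hw
      exact ⟨U, hU, by omega, by omega⟩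
    by_cases h2 : ∃ i ∈ V, ∃ j, j ∉ V ∧ StrictDesir χ i j ∧ χ (insert j (V.erase i))
    · obtain ⟨i, hi, j, hj, hsd, hw⟩ := h2
      obtain ⟨hiA, hjA⟩ := hd i j hsd
      have e1 := card_swap hi hj
      have e3 := card_inter_swap A hi hj
      simp only [hiA, hjA, if_true, if_false] at e3
      obtain ⟨U, hU, hU1, hU2⟩ := ih _ (by omega) hw
      exact ⟨U, hU, by omega, by omega⟩
    · exfalso
      push Not at h1 h2
      exact hS ⟨hV, h1, h2⟩

lemma classify {n : ℕ} {χ : Finset (Fin n) → Prop} (hs : SimpleGame n χ) (hw : IsWeighted χ)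
    (ht : NumTypes n χ = 2) (hr : NumSMWTypes n χ = 1) :
    ∃ (A : Finset (Fin n)) (a b : ℕ), 1 ≤ a ∧ a ≤ A.card ∧ b < (Aᶜ).card ∧ χ = MG A a b := by
  classical
  have hA : ∃ (A : Finset (Fin n)) (i0 j0 : Fin n), i0 ∈ A ∧ j0 ∉ A ∧
      (∀ j, VEquiv χ i0 j ↔ j ∈ A) ∧ (∀ j, VEquiv χ j0 j ↔ j ∉ A) ∧ Desir χ i0 j0 ∧
      ¬ Desir χ j0 i0 := by
    unfold NumTypes at ht
    obtain ⟨S, T, hne, hST⟩ := Set.ncard_eq_two.1 ht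
    have hSm : S ∈ {S : Set (Fin n) | ∃ i, S = {j | VEquiv χ i j}} := by rw [hST]; simp
    have hTm : T ∈ {S : Set (Fin n) | ∃ i, S = {j | VEquiv χ i j}} := by rw [hST]; simp
    obtain ⟨s, rfl⟩ := hSm
    obtain ⟨t, rfl⟩ := hTm
    have hcover : ∀ j, VEquiv χ s j ∨ VEquiv χ t j := by
      intro j
      have hj : {k | VEquiv χ j k} ∈ {S : Set (Fin n) | ∃ i, S = {j | VEquiv χ i j}} := ⟨j, rfl⟩
      have hjj : j ∈ {k | VEquiv χ j k} := ⟨desir_refl χ j, desir_refl χ j⟩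
      rw [hST] at hj
      rcases hj with hj | hj
      · left; rw [hj] at hjj; exact hjj
      · right; rw [hj] at hjj; exact hjj
    have hsymm : ∀ i j, VEquiv χ i j → VEquiv χ j i := fun i j h => ⟨h.2, h.1⟩
    have htrans : ∀ i j k, VEquiv χ i j → VEquiv χ j k → VEquiv χ i k :=
      fun i j k h1 h2 => ⟨desir_trans h1.1 h2.1, desir_trans h2.2 h1.2⟩
    have hnst : ¬ VEquiv χ s t := by
      intro h
      apply hne
      ext j
      exact ⟨fun hj => htrans _ _ _ (hsymm _ _ h) hj, fun hj => htrans _ _ _ h hj⟩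
    have main : ∀ s t, (∀ j, VEquiv χ s j ∨ VEquiv χ t j) → ¬ VEquiv χ s t → Desir χ s t →
        ∃ (A : Finset (Fin n)) (i0 j0 : Fin n), i0 ∈ A ∧ j0 ∉ A ∧
      (∀ j, VEquiv χ i0 j ↔ j ∈ A) ∧ (∀ j, VEquiv χ j0 j ↔ j ∉ A) ∧ Desir χ i0 j0 ∧
      ¬ Desir χ j0 i0 := by
      intro s t hc hn hd
      refine ⟨Finset.univ.filter (fun j => VEquiv χ s j), s, t, ?_, ?_, ?_, ?_, hd,
        fun h => hn ⟨hd, h⟩⟩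
      · simpa using ⟨desir_refl χ s, desir_refl χ s⟩
      · simpa using hn
      · intro j; simp
      · intro j
        simp only [Finset.mem_filter, Finset.mem_univ, true_and]
        refine ⟨fun h1 h2 => hn (htrans _ _ _ h2 (hsymm _ _ h1)), fun h => (hc j).resolve_left h⟩
    rcases desir_total hw s t with h | h
    · exact main s t hcover hnst h
    · exact main t s (fun j => (hcover j).symm) (fun h' => hnst (hsymm _ _ h')) h
  obtain ⟨A, i0, j0, hi0, hj0, hE1, hE2, hD, hnD⟩ := hA
  have hdes : ∀ i j, (i ∈ A ∨ j ∉ A) → Desir χ i j := by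
    intro i j h
    by_cases hi : i ∈ A
    · have e1 := ((hE1 i).2 hi).2
      by_cases hj : j ∈ A
      · exact desir_trans e1 ((hE1 j).2 hj).1
      · exact desir_trans e1 (desir_trans hD ((hE2 j).2 hj).1)
    · have hj : j ∉ A := h.resolve_left hi
      exact desir_trans ((hE2 i).2 hi).2 ((hE2 j).2 hj).1
  have hstrict : ∀ i j, StrictDesir χ i j → i ∈ A ∧ j ∉ A := by
    intro i j h
    have := fun h' => h.2 (hdes j i h')
    tauto
  have hcc1 : ∀ U : Finset (Fin n), ClassCount n χ U i0 = (U ∩ A).card := by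
    intro U
    unfold ClassCount
    simp only [hE1]
    rw [← Set.ncard_coe_finset]
    congr 1
    ext j; simp
  have hcc2 : ∀ U : Finset (Fin n), ClassCount n χ U j0 = (U \ A).card := by
    intro U
    unfold ClassCount
    simp only [hE2]
    rw [← Set.ncard_coe_finset]
    congr 1
    ext j; simp
  unfold NumSMWTypes at hr
  obtain ⟨T, hT⟩ := Set.ncard_eq_one.1 hr
  have hTm : T ∈ {T : Set (Finset (Fin n)) | ∃ U, ShiftMinWin χ U ∧
    T = {V | ShiftMinWin χ V ∧ SameType n χ U V}} := by rw [hT]; simp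
  obtain ⟨U0, hU0, hTU⟩ := hTm
  have huniq : ∀ V, ShiftMinWin χ V → (V ∩ A).card = (U0 ∩ A).card ∧ V.card = U0.card := by
    intro V hV
    have hV' : {W | ShiftMinWin χ W ∧ SameType n χ V W} ∈
        {T : Set (Finset (Fin n)) | ∃ U, ShiftMinWin χ U ∧
          T = {V | ShiftMinWin χ V ∧ SameType n χ U V}} := ⟨V, hV, rfl⟩
    rw [hT, Set.mem_singleton_iff, hTU] at hV'
    have hVV : V ∈ {W | ShiftMinWin χ W ∧ SameType n χ V W} := ⟨hV, fun _ => rfl⟩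
    rw [hV'] at hVV
    have a1 := hVV.2 i0
    have a2 := hVV.2 j0
    rw [hcc1, hcc1] at a1
    rw [hcc2, hcc2] at a2
    have k1 := card_inter_add V A
    have k2 := card_inter_add U0 A
    omega
  have k0 := card_inter_add U0 A
  have heq : χ = MG A (U0 ∩ A).card (U0 \ A).card := by
    funext V
    apply propext
    unfold MG
    rw [k0]
    constructor
    · intro hV
      obtain ⟨U, hU, h1, h2⟩ := exists_smw A hstrict _ V le_rfl hV
      have := huniq U hU
      omega
    · rintro ⟨h1, h2⟩
      exact dominate hs A hdes V _ U0 rfl hU0.1 h1 h2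
  have hcA : (U0 ∩ A).card ≤ A.card := Finset.card_le_card Finset.inter_subset_right
  have hsub : ∀ W : Finset (Fin n), (W \ A).card ≤ Aᶜ.card := fun W => by
    apply Finset.card_le_card
    intro z hz
    simp at hz ⊢
    exact hz.2
  have hcB := hsub U0
  have hnsym : ¬ ∀ V, χ V ↔ U0.card ≤ V.card := by
    intro hall
    apply hnD
    intro U h1 h2 hU
    rw [hall] at hU ⊢
    rwa [card_swap h1 h2]
  refine ⟨A, _, _, ?_, hcA, ?_, heq⟩
  · by_contra hlt
    apply hnsym
    intro V
    rw [heq]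
    unfold MG
    omega
  · by_contra hlt
    apply hnsym
    intro V
    rw [heq]
    unfold MG
    have := card_inter_add V A
    have := hsub V
    omega

lemma gameIso_symm {n : ℕ} {χ χ' : Finset (Fin n) → Prop} (h : GameIso n χ χ') :
    GameIso n χ' χ := by
  obtain ⟨σ, h⟩ := h
  refine ⟨σ⁻¹, fun U => ?_⟩
  rw [h, Finset.image_image]
  simp

lemma gameIso_trans {n : ℕ} {χ χ' χ'' : Finset (Fin n) → Prop} (h : GameIso n χ χ')
    (h' : GameIso n χ' χ'') : GameIso n χ χ'' := by
  obtain ⟨σ, h⟩ := h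
  obtain ⟨τ, h'⟩ := h'
  refine ⟨σ * τ, fun U => ?_⟩
  rw [h', h, Finset.image_image]
  rfl

lemma gameIso_refl {n : ℕ} (χ : Finset (Fin n) → Prop) : GameIso n χ χ :=
  ⟨1, fun U => by simp⟩

lemma MG_image {n : ℕ} (A : Finset (Fin n)) (a b : ℕ) (σ : Equiv.Perm (Fin n))
    (U : Finset (Fin n)) : MG (A.image σ) a b (U.image σ) ↔ MG A a b U := by
  unfold MG
  rw [← Finset.image_inter _ _ σ.injective, Finset.card_image_of_injective _ σ.injective,
    Finset.card_image_of_injective _ σ.injective]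

lemma exists_perm {n : ℕ} {A B : Finset (Fin n)} (h : A.card = B.card) :
    ∃ σ : Equiv.Perm (Fin n), A.image σ = B := by
  classical
  have e : {x // x ∈ A} ≃ {x // x ∈ B} := Fintype.equivOfCardEq (by simpa using h)
  refine ⟨e.extendSubtype, ?_⟩
  apply Finset.eq_of_subset_of_card_le
  · intro y hy
    obtain ⟨x, hx, rfl⟩ := Finset.mem_image.1 hy
    exact e.extendSubtype_mem x hx
  · rw [Finset.card_image_of_injective _ (Equiv.injective _), h]

lemma MG_iso_of_card {n : ℕ} {A B : Finset (Fin n)} (a b : ℕ) (h : A.card = B.card) :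
    GameIso n (MG A a b) (MG B a b) := by
  obtain ⟨σ, hσ⟩ := exists_perm h.symm
  refine ⟨σ, fun U => ?_⟩
  rw [← hσ, MG_image]

lemma MG_params_of_iso {n : ℕ} {A B : Finset (Fin n)} {a b c d : ℕ} (ha : 1 ≤ a)
    (haA : a ≤ A.card) (hb : b < (Aᶜ).card) (hc : 1 ≤ c)
    (hcB : c ≤ B.card) (hd : d < (Bᶜ).card) (h : GameIso n (MG A a b) (MG B c d)) :
    A.card = B.card ∧ a = c ∧ b = d := by
  obtain ⟨σ, h⟩ := h
  have hA' : (A.image σ.symm).image σ = A := by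
    rw [Finset.image_image]; simp
  have hcard : (A.image σ.symm).card = A.card :=
    Finset.card_image_of_injective _ (Equiv.injective _)
  have heq : MG B c d = MG (A.image σ.symm) a b := by
    funext U
    apply propext
    rw [h, ← MG_image (A.image σ.symm) a b σ, hA']
  rw [← hcard] at haA ⊢
  have hb' : b < ((A.image σ.symm)ᶜ).card := by
    rw [Finset.card_compl] at hb ⊢; rw [hcard]; exact hb
  clear hA' hb h
  generalize A.image σ.symm = A' at *
  have hdes : ∀ i j, (i ∈ B ∨ j ∉ B) ↔ (i ∈ A' ∨ j ∉ A') := by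
    intro i j
    rw [← MG_desir hc hcB hd, heq, MG_desir ha haA hb']
  obtain ⟨i0, hi0⟩ := Finset.card_pos.1 (show 0 < A'.card by omega)
  obtain ⟨i1, hi1⟩ := Finset.card_pos.1 (show 0 < B.card by omega)
  have hAB : A' = B := by
    ext i
    have e1 := hdes i i0
    have e2 := hdes i i1
    have e3 := hdes i0 i
    tauto
  subst hAB
  obtain ⟨U, hU⟩ := exists_type haA hb'
  have h1 := (MG_smw ha haA hb' U).2 hU
  rw [← heq, MG_smw hc hcB hd] at h1
  omega

/-- Admissible pairs `(a, b)` for class sizes `n1, n2`. -/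
def QQ (n1 n2 : ℕ) : Finset (ℕ × ℕ) :=
  (Finset.Icc 1 n1 ×ˢ Finset.range n2).filter
    (fun p => p.2 ≤ 1 ∨ p.1 = n1 ∨ p.2 + 1 = n2)

def PP (n : ℕ) : Finset (Σ _ : ℕ, ℕ × ℕ) :=
  (Finset.range (n - 1)).sigma (fun k => QQ (n - 1 - k) (k + 1))

lemma QQ_one (n1 : ℕ) : (QQ n1 1).card = n1 := by
  have : QQ n1 1 = Finset.Icc 1 n1 ×ˢ Finset.range 1 := by
    apply Finset.filter_true_of_mem
    rintro ⟨x, y⟩ h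
    simp only [Finset.mem_product, Finset.mem_range] at h
    left; simp only; omega
  rw [this]; simp

lemma QQ_two (n1 : ℕ) : (QQ n1 2).card = 2 * n1 := by
  have : QQ n1 2 = Finset.Icc 1 n1 ×ˢ Finset.range 2 := by
    apply Finset.filter_true_of_mem
    rintro ⟨x, y⟩ h
    simp only [Finset.mem_product, Finset.mem_range] at h
    left; simp only; omega
  rw [this]; simp; ring

lemma QQ_big (n1 m : ℕ) (h1 : 1 ≤ n1) : (QQ n1 (m + 3)).card = 3 * n1 + m := by
  have : QQ n1 (m + 3) = (Finset.Icc 1 n1 ×ˢ {0, 1, m + 2}) ∪ ({n1} ×ˢ Finset.Ico 2 (m + 2)) := by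
    ext ⟨x, y⟩
    simp only [QQ, Finset.mem_filter, Finset.mem_product, Finset.mem_range, Finset.mem_Icc,
      Finset.mem_union, Finset.mem_insert, Finset.mem_singleton, Finset.mem_Ico]
    omega
  rw [this, Finset.card_union_of_disjoint]
  · have : ({0, 1, m + 2} : Finset ℕ).card = 3 := by
      rw [Finset.card_eq_three]
      exact ⟨0, 1, m + 2, by omega, by omega, by omega, rfl⟩
    rw [Finset.card_product, Finset.card_product, this]
    simp; ring
  · rw [Finset.disjoint_left]
    rintro ⟨x, y⟩ h h'
    simp only [Finset.mem_product, Finset.mem_Icc,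
      Finset.mem_insert, Finset.mem_singleton, Finset.mem_Ico] at h h'
    omega

lemma sum_aux (N M : ℕ) (h : M ≤ N) :
    ∑ k ∈ Finset.range M, (3 * (N - k) + k) + M * M = 3 * N * M + M := by
  induction M with
  | zero => simp
  | succ M ih =>
    rw [Finset.sum_range_succ]
    have := ih (by omega)
    obtain ⟨d, rfl⟩ := Nat.exists_eq_add_of_lt (show M < N by omega)
    rw [show M + d + 1 - M = d + 1 by omega]
    nlinarith

lemma PP_card (n : ℕ) (hn : 3 ≤ n) : (PP n).card = 2 * (n - 2) ^ 2 + 2 := by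
  obtain ⟨N, rfl⟩ := Nat.exists_eq_add_of_le' hn
  unfold PP
  rw [Finset.card_sigma, show N + 3 - 1 = N + 2 by omega, Finset.sum_range_succ',
    Finset.sum_range_succ']
  have : ∀ k ∈ Finset.range N, (QQ (N + 2 - (k + 1 + 1)) (k + 1 + 1 + 1)).card
      = 3 * (N - k) + k := by
    intro k hk
    rw [Finset.mem_range] at hk
    rw [QQ_big _ _ (by omega)]
    omega
  rw [Finset.sum_congr rfl this]
  have e := sum_aux N N le_rfl
  simp only [zero_add]
  rw [QQ_one, show (1 : ℕ) + 1 = 2 by rfl, QQ_two, show N + 2 - 1 = N + 1 by omega,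
    show N + 3 - 2 = N + 1 by omega, Nat.sub_zero]
  nlinarith

/-- The first `m` voters. -/
def firstVoters (n m : ℕ) : Finset (Fin n) := Finset.univ.filter (fun i => (i : ℕ) < m)

lemma firstVoters_card {n m : ℕ} (h : m ≤ n) : (firstVoters n m).card = m := by
  unfold firstVoters
  rw [Fin.card_filter_val_lt]
  exact min_eq_right h

def canon (n : ℕ) (p : Σ _ : ℕ, ℕ × ℕ) : Finset (Fin n) → Prop :=
  MG (firstVoters n (n - 1 - p.1)) p.2.1 p.2.2

lemma mem_PP {n : ℕ} {p : Σ _ : ℕ, ℕ × ℕ} :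
    p ∈ PP n ↔ (p.1 < n - 1 ∧ 1 ≤ p.2.1 ∧ p.2.1 ≤ n - 1 - p.1 ∧ p.2.2 < p.1 + 1 ∧
      (p.2.2 ≤ 1 ∨ p.2.1 = n - 1 - p.1 ∨ p.2.2 + 1 = p.1 + 1)) := by
  simp only [PP, QQ, Finset.mem_sigma, Finset.mem_filter, Finset.mem_product, Finset.mem_range,
    Finset.mem_Icc]
  tauto

lemma wm_eq (n : ℕ) : wmntr n 2 1 = (PP n).card := by
  unfold wmntr
  have hclass : ∀ χ χ' : Finset (Fin n) → Prop, GameIso n χ χ' →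
      {ψ | GameIso n χ ψ} = {ψ | GameIso n χ' ψ} := by
    intro χ χ' h
    ext ψ
    exact ⟨fun h' => gameIso_trans (gameIso_symm h) h', fun h' => gameIso_trans h h'⟩
  have hset : {C : Set (Finset (Fin n) → Prop) | ∃ χ, SimpleGame n χ ∧ IsWeighted χ ∧
      NumTypes n χ = 2 ∧ NumSMWTypes n χ = 1 ∧ C = {χ' | GameIso n χ χ'}}
      = (fun p => {χ' | GameIso n (canon n p) χ'}) '' (PP n : Set (Σ _ : ℕ, ℕ × ℕ)) := by
    ext C
    constructor
    · rintro ⟨χ, hs, hw, ht, hr, rfl⟩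
      obtain ⟨A, a, b, ha, haA, hb, rfl⟩ := classify hs hw ht hr
      have hcond := MG_cond_of_weighted ha haA hb hw
      have hcc : A.card + Aᶜ.card = n := by
        have := Finset.card_add_card_compl A
        simpa using this
      refine ⟨⟨Aᶜ.card - 1, a, b⟩, ?_, ?_⟩
      · rw [Finset.mem_coe, mem_PP]
        simp only
        omega
      · apply hclass
        apply MG_iso_of_card
        simp only
        rw [firstVoters_card (by omega)]
        omega
    · rintro ⟨⟨k, a, b⟩, hp, rfl⟩
      rw [Finset.mem_coe, mem_PP] at hp
      simp only at hp
      obtain ⟨h1, h2, h3, h4, h5⟩ := hp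
      have hc1 := firstVoters_card (show n - 1 - k ≤ n by omega)
      have hcc := Finset.card_add_card_compl (firstVoters n (n - 1 - k))
      rw [Fintype.card_fin] at hcc
      have g1 : a ≤ (firstVoters n (n - 1 - k)).card := by omega
      have g2 : b < ((firstVoters n (n - 1 - k))ᶜ).card := by omega
      have hcond : b ≤ 1 ∨ a = (firstVoters n (n - 1 - k)).card ∨
          b + 1 = ((firstVoters n (n - 1 - k))ᶜ).card := by omega
      exact ⟨canon n ⟨k, a, b⟩, MG_simple h2 g1 g2, MG_weighted g1 g2 hcond,
        MG_numTypes h2 g1 g2, MG_numSMW h2 g1 g2, rfl⟩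
  rw [hset, Set.InjOn.ncard_image, Set.ncard_coe_finset]
  rintro ⟨k, a, b⟩ hp ⟨k', a', b'⟩ hp' heq
  rw [Finset.mem_coe, mem_PP] at hp hp'
  simp only at hp hp' heq
  have hiso : GameIso n (canon n ⟨k, a, b⟩) (canon n ⟨k', a', b'⟩) := by
    have : canon n ⟨k', a', b'⟩ ∈ {χ' | GameIso n (canon n ⟨k', a', b'⟩) χ'} := gameIso_refl _
    rw [← heq] at this
    exact this
  have hc1 := firstVoters_card (show n - 1 - k ≤ n by omega)
  have hcc := Finset.card_add_card_compl (firstVoters n (n - 1 - k))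
  have hc1' := firstVoters_card (show n - 1 - k' ≤ n by omega)
  have hcc' := Finset.card_add_card_compl (firstVoters n (n - 1 - k'))
  rw [Fintype.card_fin] at hcc hcc'
  unfold canon at hiso
  simp only at hiso
  have := MG_params_of_iso (n := n) (A := firstVoters n (n - 1 - k)) (B := firstVoters n (n - 1 - k'))
    (a := a) (b := b) (c := a') (d := b') (by omega) (by omega) (by omega) (by omega) (by omega) (by omega) hiso
  obtain ⟨e1, rfl, rfl⟩ := this
  have : k = k' := by omega
  subst this
  rfl

theorem stmt16 (n : ℕ) :
    (3 ≤ n → wmntr n 2 1 = 2 * (n - 2) ^ 2 + 2) ∧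
    (n ≤ 2 → wmntr n 2 1 = n - 1) := by
  rw [wm_eq]
  refine ⟨PP_card n, fun h => ?_⟩
  interval_cases n <;> decide
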